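/- A reduced irreducible ruled surface S ⊂ ℙ(V) of degree d ≥ 3, not a cone, can have at most two isolated lines. If S has two isolated lines w̄₁ and w̄₂, then these lines are disjoint: w̄₁ ∩ w̄₂ = ∅. -/

import Mathlib

namespace RQS

open MvPolynomial

open MvPolynomial

variable (K : Type) [Field K]

/-- Projective n-space modelled as the projectivization of `Fin n → K`
(so `PP K (n+1)` is ℙⁿ). -/
abbrev PP (n : ℕ) : Type := Projectivization K (Fin n → K)

variable {K}

/-- Vanishing of a (homogeneous) polynomial at a projective point. -/
def vanishes {n : ℕ} (p : MvPolynomial (Fin n) K) (x : PP K n) : Prop :=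
  ∀ (v : Fin n → K) (h : v ≠ 0), Projectivization.mk K v h = x → eval v p = 0

/-- Projective zero locus of a set of polynomials. -/
def zeroLocus {n : ℕ} (S : Set (MvPolynomial (Fin n) K)) : Set (PP K n) :=
  {x | ∀ p ∈ S, vanishes p x}

/-- Zariski closed subsets of projective space. -/
def ZClosed {n : ℕ} (X : Set (PP K n)) : Prop :=
  ∃ S : Set (MvPolynomial (Fin n) K), (∀ p ∈ S, ∃ d, p.IsHomogeneous d) ∧ X = zeroLocus S

/-- Irreducibility with respect to the Zariski topology. -/
def ZIrred {n : ℕ} (X : Set (PP K n)) : Prop :=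
  X.Nonempty ∧ ∀ A B : Set (PP K n), ZClosed A → ZClosed B → X ⊆ A ∪ B → X ⊆ A ∨ X ⊆ B

/-- `X` contains a chain of closed irreducible subsets of length `d+1`. -/
def dimGE {n : ℕ} (X : Set (PP K n)) (d : ℕ) : Prop :=
  ∃ f : Fin (d + 1) → Set (PP K n),
    (∀ i, ZClosed (f i) ∧ ZIrred (f i) ∧ f i ⊆ X) ∧ StrictMono f

/-- `X` has (Krull) dimension exactly `d`. -/
def HasDim {n : ℕ} (X : Set (PP K n)) (d : ℕ) : Prop := dimGE X d ∧ ¬ dimGE X (d + 1)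

/-- The hyperplane with coefficient vector `φ`. -/
def hyp {n : ℕ} (φ : Fin n → K) : Set (PP K n) :=
  {x | ∀ (v : Fin n → K) (h : v ≠ 0), Projectivization.mk K v h = x → ∑ i, φ i * v i = 0}

/-- Degree of a (reduced) curve: every hyperplane not containing it meets it in at most `d`
points, and some hyperplane meets it in exactly `d` points. -/
def HasCurveDeg {n : ℕ} (X : Set (PP K n)) (d : ℕ) : Prop :=
  (∀ φ : Fin n → K, φ ≠ 0 → ¬ X ⊆ hyp φ →
    (X ∩ hyp φ).Finite ∧ (X ∩ hyp φ).ncard ≤ d) ∧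
  (∃ φ : Fin n → K, φ ≠ 0 ∧ ¬ X ⊆ hyp φ ∧ (X ∩ hyp φ).ncard = d)

/-- An irreducible projective curve of degree `d`. -/
def IsCurveOfDeg {n : ℕ} (X : Set (PP K n)) (d : ℕ) : Prop :=
  ZClosed X ∧ ZIrred X ∧ HasDim X 1 ∧ HasCurveDeg X d

/-- A property holds at a general point of `S`. -/
def GenericPts {n : ℕ} (S : Set (PP K n)) (Q : PP K n → Prop) : Prop :=
  ∃ T : Set (PP K n), ZClosed T ∧ ¬ S ⊆ T ∧ ∀ p ∈ S, p ∉ T → Q p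

/-! ### Plücker coordinates: `p₁₂,p₁₃,p₁₄,p₂₃,p₂₄,p₃₄` indexed by `0,…,5` -/

/-- Plücker coordinates of the line through `u` and `v`, i.e. the bivector `u ∧ v`. -/
def plucker (u v : Fin 4 → K) : Fin 6 → K :=
  ![u 0 * v 1 - u 1 * v 0, u 0 * v 2 - u 2 * v 0, u 0 * v 3 - u 3 * v 0,
    u 1 * v 2 - u 2 * v 1, u 1 * v 3 - u 3 * v 1, u 2 * v 3 - u 3 * v 2]

/-- The Plücker quadric `p₁₂p₃₄ - p₁₃p₂₄ + p₁₄p₂₃`, i.e. `½ w ∧ w`. -/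
def plQuad (w : Fin 6 → K) : K := w 0 * w 5 - w 1 * w 4 + w 2 * w 3

/-- The wedge pairing `w ∧ z ∈ Λ⁴V ≅ K` of two bivectors. -/
def plPair (w z : Fin 6 → K) : K :=
  w 0 * z 5 + w 5 * z 0 - w 1 * z 4 - w 4 * z 1 + w 2 * z 3 + w 3 * z 2

/-- The wedge `w ∧ v ∈ Λ³V ≅ V*` of a bivector `w` with a vector `v`;
`w ∧ v = 0` expresses that the point `v̄` lies on the line `w̄`. -/
def wedgePt (w : Fin 6 → K) (v : Fin 4 → K) : Fin 4 → K :=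
  ![w 0 * v 2 - w 1 * v 1 + w 3 * v 0,
    w 0 * v 3 - w 2 * v 1 + w 4 * v 0,
    w 1 * v 3 - w 2 * v 2 + w 5 * v 0,
    w 3 * v 3 - w 4 * v 2 + w 5 * v 1]

/-- The set of points of ℙ³ on the line with Plücker vector `w`. -/
def lineOfRep (w : Fin 6 → K) : Set (PP K 4) :=
  {p | ∀ (v : Fin 4 → K) (h : v ≠ 0), Projectivization.mk K v h = p → wedgePt w v = 0}

/-- `w` represents a line of ℙ³: it is nonzero and decomposable. -/
def IsLineRep (w : Fin 6 → K) : Prop := w ≠ 0 ∧ plQuad w = 0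

variable (K) in
/-- The Grassmannian `Gr(2,4) ⊂ ℙ⁵` of lines in ℙ³. -/
def grass : Set (PP K 6) :=
  {x | ∃ (w : Fin 6 → K) (h : w ≠ 0), Projectivization.mk K w h = x ∧ plQuad w = 0}

/-- The line in ℙ³ corresponding to a point `x` of the Grassmannian. -/
def lineOf (x : PP K 6) : Set (PP K 4) :=
  {p | ∀ (w : Fin 6 → K) (h : w ≠ 0), Projectivization.mk K w h = x → p ∈ lineOfRep w}

/-- The set of (Grassmann points of) lines contained in a surface `S ⊂ ℙ³`. -/
def linesOf (S : Set (PP K 4)) : Set (PP K 6) :=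
  {x | x ∈ grass K ∧ lineOf x ⊆ S}

/-- A ruled surface: an irreducible closed surface which is a union of lines. -/
def IsRuled (S : Set (PP K 4)) : Prop :=
  ZClosed S ∧ ZIrred S ∧ HasDim S 2 ∧ ∀ p ∈ S, ∃ x ∈ linesOf S, p ∈ lineOf x

/-- Degree of a surface in ℙ³ via intersections with lines. -/
def HasSurfDeg (S : Set (PP K 4)) (d : ℕ) : Prop :=
  (∀ w : Fin 6 → K, IsLineRep w → ¬ lineOfRep w ⊆ S →
    (S ∩ lineOfRep w).Finite ∧ (S ∩ lineOfRep w).ncard ≤ d) ∧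
  (∃ w : Fin 6 → K, IsLineRep w ∧ ¬ lineOfRep w ⊆ S ∧ (S ∩ lineOfRep w).ncard = d)

/-- A cone: all lines of `S` pass through a common point. -/
def IsCone (S : Set (PP K 4)) : Prop :=
  ∃ p : PP K 4, ∀ x ∈ linesOf S, p ∈ lineOf x

/-- `σ₂(p₀)`: the 2-plane in the Grassmannian of all lines through `p₀`. -/
def sigma2 (p₀ : PP K 4) : Set (PP K 6) := {x | x ∈ grass K ∧ p₀ ∈ lineOf x}

/-- The projective tangent space `T_{Gr,x₀}` of the Plücker quadric at `x₀`,
namely the hyperplane `{z̄ : w₀ ∧ z = 0}`. -/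
def tangentGr (x₀ : PP K 6) : Set (PP K 6) :=
  {x | ∀ (w : Fin 6 → K) (h : w ≠ 0), Projectivization.mk K w h = x →
    ∀ (w₀ : Fin 6 → K) (h₀ : w₀ ≠ 0), Projectivization.mk K w₀ h₀ = x₀ → plPair w₀ w = 0}

/-- The linear span of (the representatives of) a subset of projective space. -/
def spanOfSet {n : ℕ} (X : Set (PP K n)) : Submodule K (Fin n → K) :=
  Submodule.span K {v | ∃ h : v ≠ 0, Projectivization.mk K v h ∈ X}

/-- The projective subspace associated to a linear subspace. -/
def projSub {n : ℕ} (U : Submodule K (Fin n → K)) : Set (PP K n) :=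
  {x | ∀ (v : Fin n → K) (h : v ≠ 0), Projectivization.mk K v h = x → v ∈ U}

/-- `P(C)`: the smallest projective subspace containing `C`. -/
def projSpanOf {n : ℕ} (X : Set (PP K n)) : Set (PP K n) := projSub (spanOfSet X)

/-! ### Smoothness via Jacobian criteria -/

/-- The homogeneous polynomials vanishing on `X`. -/
def homIdeal {n : ℕ} (X : Set (PP K n)) : Set (MvPolynomial (Fin n) K) :=
  {p | (∃ d, p.IsHomogeneous d) ∧ ∀ x ∈ X, vanishes p x}

/-- The span of the gradients at `v` of all homogeneous polynomials vanishing on `X`. -/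
def gradSpan {n : ℕ} (X : Set (PP K n)) (v : Fin n → K) : Submodule K (Fin n → K) :=
  Submodule.span K
    {g | ∃ p ∈ homIdeal X, g = fun i => eval v (pderiv i p)}

/-- Smooth point of a projective *curve* `X ⊂ ℙ(Kⁿ)` (Jacobian criterion:
the affine cone over `X` has a 2-dimensional tangent space there). -/
def CurveSmoothPt {n : ℕ} (X : Set (PP K n)) (x : PP K n) : Prop :=
  ∀ (v : Fin n → K) (h : v ≠ 0), Projectivization.mk K v h = x →
    Module.finrank K (gradSpan X v) = n - 2

/-- Smooth point of a *surface* `S ⊂ ℙ³` (Jacobian criterion). -/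
def SurfSmoothPt (S : Set (PP K 4)) (x : PP K 4) : Prop :=
  ∀ (v : Fin 4 → K) (h : v ≠ 0), Projectivization.mk K v h = x →
    Module.finrank K (gradSpan S v) = 1

/-- The singular locus of a surface `S ⊂ ℙ³`. -/
def singLocus (S : Set (PP K 4)) : Set (PP K 4) := {x ∈ S | ¬ SurfSmoothPt S x}

/-! ### Homogeneous polynomials and cones -/

theorem eval_smul_of_isHomogeneous {n d : ℕ} {p : MvPolynomial (Fin n) K}
    (hp : p.IsHomogeneous d) (t : K) (v : Fin n → K) :
    eval (t • v) p = t ^ d * eval v p := by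
  rw [eval_eq', eval_eq', Finset.mul_sum]
  refine Finset.sum_congr rfl fun α hα => ?_
  have hdeg : ∑ i, α i = d := by
    simpa [Finsupp.weight_apply, Finsupp.sum_fintype] using hp (mem_support_iff.mp hα)
  simp only [Pi.smul_apply, smul_eq_mul, mul_pow, Finset.prod_mul_distrib,
    Finset.prod_pow_eq_pow_sum, hdeg]
  ring

/-- A polynomial vanishing on all multiples of a vector has all its homogeneous components
vanishing there. -/
theorem eval_homogeneousComponent_eq_zero [Infinite K] {n : ℕ} {p : MvPolynomial (Fin n) K}
    {v : Fin n → K} (h : ∀ t : K, eval (t • v) p = 0) (i : ℕ) :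
    eval v (homogeneousComponent i p) = 0 := by
  set q : Polynomial K := ∑ j ∈ Finset.range (p.totalDegree + 1),
    Polynomial.C (eval v (homogeneousComponent j p)) * Polynomial.X ^ j with hq
  have hq0 : q = 0 := by
    refine Polynomial.funext fun t => ?_
    have ht := h t
    rw [← sum_homogeneousComponent p, map_sum] at ht
    simp only [eval_smul_of_isHomogeneous (homogeneousComponent_isHomogeneous _ p)] at ht
    simp only [hq, Polynomial.eval_finsetSum, Polynomial.eval_mul, Polynomial.eval_C,
      Polynomial.eval_pow, Polynomial.eval_X, Polynomial.eval_zero, ← ht]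
    exact Finset.sum_congr rfl fun j _ => mul_comm _ _
  rcases lt_or_ge p.totalDegree i with hi | hi
  · rw [homogeneousComponent_eq_zero i p hi, map_zero]
  · have hc := congrArg (fun r => Polynomial.coeff r i) hq0
    simpa [hq, Polynomial.finsetSum_coeff, Polynomial.coeff_C_mul, Polynomial.coeff_X_pow,
      Nat.lt_succ_iff, hi] using hc

theorem exists_forall_monomial_mem [IsAlgClosed K] {m : ℕ} {J : Ideal (MvPolynomial (Fin m) K)}
    (hJ : ∀ w ∈ MvPolynomial.zeroLocus K J, w = 0) :
    ∃ N : ℕ, ∀ α : Fin m →₀ ℕ, α.degree = N → monomial α (1 : K) ∈ J := by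
  have hle : Ideal.span (Set.range (X : Fin m → MvPolynomial (Fin m) K)) ≤ J.radical := by
    rw [Ideal.span_le]
    rintro _ ⟨i, rfl⟩
    rw [← vanishingIdeal_zeroLocus_eq_radical (K := K)]
    intro w hw
    simp [hJ w hw]
  obtain ⟨N, hN⟩ := Ideal.exists_pow_le_of_le_radical_of_fg hle
    (IsNoetherian.noetherian _)
  refine ⟨N, fun α hα => hN ?_⟩
  rw [monomial_eq, C_1, one_mul, ← hα, Finsupp.degree_eq_sum, Finsupp.prod_fintype _ _ (by simp),
    ← Finset.prod_pow_eq_pow_sum]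
  exact Ideal.prod_mem_prod fun i _ => Ideal.pow_mem_pow (Ideal.subset_span (Set.mem_range_self i)) _

/-- Elimination: let `T` define a cone of vectors `w` and consider the bilinear incidence relation
`∑ l, v l * A j l (w) = 0` with `A j l` linear forms. If no nonzero `w` in the cone is incident
to `v₀`, some polynomial separates `v₀` from all `v` incident to a nonzero `w` of the cone. -/
theorem exists_separating_polynomial [IsAlgClosed K] {m n k : ℕ}
    {T : Set (MvPolynomial (Fin m) K)} (hT : ∀ f ∈ T, ∃ d, f.IsHomogeneous d)
    {A : Fin k → Fin n → MvPolynomial (Fin m) K} (hA : ∀ j l, (A j l).IsHomogeneous 1)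
    {v₀ : Fin n → K}
    (h₀ : ∀ w, (∀ f ∈ T, eval w f = 0) → (∀ j, ∑ l, v₀ l * eval w (A j l) = 0) → w = 0) :
    ∃ b : MvPolynomial (Fin n) K, eval v₀ b ≠ 0 ∧
      ∀ v w, w ≠ 0 → (∀ f ∈ T, eval w f = 0) → (∀ j, ∑ l, v l * eval w (A j l) = 0) →
        eval v b = 0 := by
  classical
  have hcone : ∀ w, (∀ f ∈ T, eval w f = 0) → ∀ t : K, ∀ f ∈ T, eval (t • w) f = 0 := by
    intro w hw t f hf
    obtain ⟨d, hd⟩ := hT f hf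
    rw [eval_smul_of_isHomogeneous hd, hw f hf, mul_zero]
  set L : Fin k → MvPolynomial (Fin m) K := fun j => ∑ l, C (v₀ l) * A j l with hL
  obtain ⟨N, hN⟩ := exists_forall_monomial_mem (J := Ideal.span T ⊔ Ideal.span (Set.range L)) <| by
    intro w hw
    refine h₀ w (fun f hf => hw f (Ideal.mem_sup_left (Ideal.subset_span hf))) fun j => ?_
    simpa [hL] using hw (L j) (Ideal.mem_sup_right (Ideal.subset_span ⟨j, rfl⟩))
  have key : ∀ α : Fin m →₀ ℕ, α.degree = N → ∃ H : Fin n → MvPolynomial (Fin m) K,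
      (∀ l, (H l).IsHomogeneous N) ∧ ∀ w, (∀ f ∈ T, eval w f = 0) →
        eval w (monomial α (1 : K)) = ∑ l, v₀ l * eval w (H l) ∧
        ∀ v : Fin n → K, (∀ j, ∑ l, v l * eval w (A j l) = 0) → ∑ l, v l * eval w (H l) = 0 := by
    intro α hα
    obtain ⟨F, hF, G, hG, hFG⟩ := Submodule.mem_sup.mp (hN α hα)
    obtain ⟨h, rfl⟩ := Ideal.mem_span_range_iff_exists_fun.mp hG
    refine ⟨fun l => homogeneousComponent N (∑ j, h j * A j l),
      fun l => homogeneousComponent_isHomogeneous _ _, fun w hw => ⟨?_, fun v hv => ?_⟩⟩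
    · have hFw : eval w (homogeneousComponent N F) = 0 := by
        refine eval_homogeneousComponent_eq_zero (fun t => ?_) N
        have hle : Ideal.span T ≤ RingHom.ker (eval (t • w)) :=
          Ideal.span_le.mpr fun f hf => hcone w hw t f hf
        exact hle hF
      have hmon : (monomial α (1 : K)).IsHomogeneous N := isHomogeneous_monomial _ hα
      have hsum : ∑ j, h j * L j = ∑ l, C (v₀ l) * ∑ j, h j * A j l := by
        simp only [hL, Finset.mul_sum]
        rw [Finset.sum_comm]
        exact Finset.sum_congr rfl fun l _ => Finset.sum_congr rfl fun j _ => by ring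
      rw [← homogeneousComponent_eq_self hmon, ← hFG, hsum, map_add, map_add, hFw, zero_add,
        map_sum, map_sum]
      simp only [homogeneousComponent_C_mul, map_mul, eval_C]
    · have hv0 : eval w (homogeneousComponent N (∑ l, C (v l) * ∑ j, h j * A j l)) = 0 := by
        refine eval_homogeneousComponent_eq_zero (fun t => ?_) N
        simp only [map_sum, map_mul, eval_C, Finset.mul_sum]
        rw [Finset.sum_comm]
        refine Finset.sum_eq_zero fun j _ => ?_
        calc ∑ l, v l * (eval (t • w) (h j) * eval (t • w) (A j l))
            = eval (t • w) (h j) * t * ∑ l, v l * eval w (A j l) := by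
              rw [Finset.mul_sum]
              refine Finset.sum_congr rfl fun l _ => ?_
              rw [eval_smul_of_isHomogeneous (hA j l)]
              ring
          _ = 0 := by rw [hv j, mul_zero]
      rw [map_sum, map_sum] at hv0
      simpa only [homogeneousComponent_C_mul, map_mul, eval_C] using hv0
  choose! H hHhom hH using key
  let ι := (Finset.univ : Finset (Fin m)).finsuppAntidiag N
  have hι : ∀ α : Fin m →₀ ℕ, α ∈ ι ↔ α.degree = N := fun α => by
    simp [ι, Finset.mem_finsuppAntidiag, Finsupp.degree_eq_sum]
  let M : Matrix ι ι (MvPolynomial (Fin n) K) := Matrix.of fun α β =>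
    ∑ l, (C (v₀ l) - X l) * C (coeff β.1 (H α.1 l))
  have hMeval : ∀ v α β, eval v ((1 - M) α β) =
      (1 : Matrix ι ι K) α β - ∑ l, (v₀ l - v l) * coeff β.1 (H α.1 l) := by
    intro v α β
    simp only [Matrix.sub_apply, Matrix.of_apply, map_sub, M, map_sum, map_mul, eval_C, eval_X,
      Matrix.one_apply]
    split_ifs <;> simp
  refine ⟨(1 - M).det, ?_, fun v w hw hwT hwv => ?_⟩
  · have : (eval v₀).mapMatrix (1 - M) = 1 := by
      ext α β
      rw [RingHom.mapMatrix_apply, Matrix.map_apply, hMeval]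
      simp
    rw [RingHom.map_det, this, Matrix.det_one]
    exact one_ne_zero
  · rw [RingHom.map_det, ← Matrix.exists_mulVec_eq_zero_iff]
    refine ⟨fun β => eval w (monomial β.1 (1 : K)), ?_, ?_⟩
    · obtain ⟨i, hi⟩ := Function.ne_iff.mp hw
      intro h
      have hz := congrFun h ⟨Finsupp.single i N, (hι _).mpr (by simp)⟩
      simp only [eval_monomial, one_mul, Pi.zero_apply] at hz
      rw [Finsupp.prod_single_index (by simp)] at hz
      exact hi (eq_zero_of_pow_eq_zero hz)
    · ext α
      have hα := (hι α.1).mp α.2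
      have hexp : ∀ l, ∑ β : ι, coeff β.1 (H α.1 l) * eval w (monomial β.1 (1 : K)) =
          eval w (H α.1 l) := by
        intro l
        rw [Finset.sum_coe_sort ι fun β => coeff β (H α.1 l) * eval w (monomial β (1 : K)),
          eval_eq, ← Finset.sum_subset (s₁ := (H α.1 l).support)]
        · refine Finset.sum_congr rfl fun β _ => ?_
          rw [eval_monomial, one_mul, Finsupp.prod]
        · intro β hβ
          rw [hι, Finsupp.degree_eq_sum]
          simpa [Finsupp.weight_apply, Finsupp.sum_fintype] using
            hHhom α.1 hα l (mem_support_iff.mp hβ)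
        · intro β _ hβ
          rw [notMem_support_iff.mp hβ, zero_mul]
      obtain ⟨h1, h2⟩ := hH α.1 hα w hwT
      calc ∑ β : ι, eval v ((1 - M) α β) * eval w (monomial β.1 (1 : K))
          = eval w (monomial α.1 (1 : K)) - ∑ l, (v₀ l - v l) *
              ∑ β : ι, coeff β.1 (H α.1 l) * eval w (monomial β.1 (1 : K)) := by
            simp only [hMeval, sub_mul, Finset.sum_sub_distrib, Matrix.one_apply, ite_mul, one_mul,
              zero_mul, Finset.sum_ite_eq, Finset.mem_univ, if_true, Finset.sum_mul,
              Finset.mul_sum, mul_assoc]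
            rw [Finset.sum_comm, Finset.sum_comm (s := Finset.univ (α := ι))]
        _ = 0 := by
            simp only [hexp, sub_mul, Finset.sum_sub_distrib]
            rw [h2 v hwv, h1]
            ring

/-! ### Zariski closed sets -/

theorem exists_smul_rep_eq {n : ℕ} {v : Fin n → K} {h : v ≠ 0} {x : PP K n}
    (hx : Projectivization.mk K v h = x) : ∃ t : K, t ≠ 0 ∧ t • x.rep = v := by
  subst hx
  obtain ⟨a, ha⟩ := Projectivization.exists_smul_eq_mk_rep K v h
  exact ⟨(a⁻¹ : Kˣ), Units.ne_zero _, by rw [← ha]; exact inv_smul_smul a v⟩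

theorem vanishes_iff {n d : ℕ} {p : MvPolynomial (Fin n) K} (hp : p.IsHomogeneous d)
    {x : PP K n} : vanishes p x ↔ eval x.rep p = 0 := by
  refine ⟨fun h => h _ x.rep_nonzero x.mk_rep, fun h v hv hx => ?_⟩
  obtain ⟨t, -, rfl⟩ := exists_smul_rep_eq hx
  rw [eval_smul_of_isHomogeneous hp, h, mul_zero]

theorem zClosed_of_forall_notMem {n : ℕ} {X : Set (PP K n)}
    (h : ∀ x ∉ X, ∃ p : MvPolynomial (Fin n) K, (∃ d, p.IsHomogeneous d) ∧
      (∀ y ∈ X, eval y.rep p = 0) ∧ eval x.rep p ≠ 0) : ZClosed X := by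
  refine ⟨homIdeal X, fun p hp => hp.1, Set.Subset.antisymm (fun x hx p hp => hp.2 x hx) ?_⟩
  intro x hx
  by_contra hxX
  obtain ⟨p, ⟨d, hd⟩, hpX, hpx⟩ := h x hxX
  exact hpx ((vanishes_iff hd).mp
    (hx p ⟨⟨d, hd⟩, fun y hy => (vanishes_iff hd).mpr (hpX y hy)⟩))

theorem ZClosed.exists_separating {n : ℕ} {X : Set (PP K n)} (hX : ZClosed X) {x : PP K n}
    (hx : x ∉ X) : ∃ p : MvPolynomial (Fin n) K, (∃ d, p.IsHomogeneous d) ∧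
      (∀ y ∈ X, eval y.rep p = 0) ∧ eval x.rep p ≠ 0 := by
  obtain ⟨T, hT, rfl⟩ := hX
  obtain ⟨p, hp, hpx⟩ : ∃ p ∈ T, ¬ vanishes p x := by
    by_contra! h
    exact hx h
  obtain ⟨d, hd⟩ := hT p hp
  exact ⟨p, ⟨d, hd⟩, fun y hy => (vanishes_iff hd).mp (hy p hp),
    fun h => hpx ((vanishes_iff hd).mpr h)⟩

theorem zClosed_empty {n : ℕ} : ZClosed (∅ : Set (PP K n)) :=
  zClosed_of_forall_notMem fun _ _ => ⟨1, ⟨0, isHomogeneous_one _ _⟩, by simp, by simp⟩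

theorem ZClosed.union {n : ℕ} {A B : Set (PP K n)} (hA : ZClosed A) (hB : ZClosed B) :
    ZClosed (A ∪ B) := by
  refine zClosed_of_forall_notMem fun x hx => ?_
  obtain ⟨p, ⟨d, hd⟩, hpA, hpx⟩ := hA.exists_separating fun h => hx (Or.inl h)
  obtain ⟨q, ⟨e, he⟩, hqB, hqx⟩ := hB.exists_separating fun h => hx (Or.inr h)
  refine ⟨p * q, ⟨d + e, hd.mul he⟩, ?_, by simp [hpx, hqx]⟩
  rintro y (hy | hy)
  · simp [hpA y hy]
  · simp [hqB y hy]

theorem ZClosed.biUnion {n : ℕ} {ι : Type*} {s : Set ι} (hs : s.Finite)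
    {A : ι → Set (PP K n)} (hA : ∀ i ∈ s, ZClosed (A i)) : ZClosed (⋃ i ∈ s, A i) := by
  induction s, hs using Set.Finite.induction_on with
  | empty => simpa using zClosed_empty
  | @insert a s _ _ ih =>
    rw [Set.biUnion_insert]
    exact (hA a (Set.mem_insert _ _)).union (ih fun i hi => hA i (Set.mem_insert_of_mem _ hi))

theorem ZIrred.exists_subset_of_finite {n : ℕ} {X : Set (PP K n)} (hX : ZIrred X) {ι : Type*}
    {s : Set ι} (hs : s.Finite) {A : ι → Set (PP K n)} (hA : ∀ i ∈ s, ZClosed (A i))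
    (h : X ⊆ ⋃ i ∈ s, A i) : ∃ i ∈ s, X ⊆ A i := by
  induction s, hs using Set.Finite.induction_on with
  | empty =>
    obtain ⟨x, hx⟩ := hX.1
    simpa using h hx
  | @insert a s _ hs ih =>
    rw [Set.biUnion_insert] at h
    have hA' : ∀ i ∈ s, ZClosed (A i) := fun i hi => hA i (Set.mem_insert_of_mem _ hi)
    rcases hX.2 _ _ (hA a (Set.mem_insert _ _)) (ZClosed.biUnion hs hA') h with h | h
    · exact ⟨a, Set.mem_insert _ _, h⟩
    · obtain ⟨i, hi, hXi⟩ := ih hA' h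
      exact ⟨i, Set.mem_insert_of_mem _ hi, hXi⟩

theorem zClosed_setOf_linear {n m : ℕ} (f : (Fin n → K) →ₗ[K] (Fin m → K)) :
    ZClosed {x : PP K n | f x.rep = 0} := by
  refine zClosed_of_forall_notMem fun x hx => ?_
  obtain ⟨j, hj⟩ := Function.ne_iff.mp (show f x.rep ≠ 0 from hx)
  have hev : ∀ v, eval v (∑ i, C (f (Pi.single i 1) j) * X i) = f v j := by
    intro v
    have hv := congrFun (LinearMap.pi_apply_eq_sum_univ f v) j
    rw [hv]
    simp only [map_sum, map_mul, eval_C, eval_X, Finset.sum_apply, Pi.smul_apply, smul_eq_mul]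
    refine Finset.sum_congr rfl fun i _ => ?_
    have hsingle : (Pi.single i 1 : Fin n → K) = fun k => if i = k then 1 else 0 := by
      ext k
      simp [Pi.single_apply, eq_comm]
    rw [hsingle, mul_comm]
  refine ⟨∑ i, C (f (Pi.single i 1) j) * X i, ⟨1, ?_⟩, fun y hy => ?_, ?_⟩
  · exact IsHomogeneous.sum _ _ _ fun i _ => (isHomogeneous_X K i).C_mul _
  · rw [hev, show f y.rep = 0 from hy, Pi.zero_apply]
  · rw [hev]
    exact hj

/-! ### Lines as planes of vectors -/

/-- The bilinear map `(w, v) ↦ w ∧ v`. -/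
def wedgeMap : (Fin 6 → K) →ₗ[K] (Fin 4 → K) →ₗ[K] (Fin 4 → K) :=
  LinearMap.mk₂ K wedgePt
    (fun w w' v => by ext i; fin_cases i <;> simp [wedgePt] <;> ring)
    (fun c w v => by ext i; fin_cases i <;> simp [wedgePt] <;> ring)
    (fun w v v' => by ext i; fin_cases i <;> simp [wedgePt] <;> ring)
    (fun c w v => by ext i; fin_cases i <;> simp [wedgePt] <;> ring)

/-- The vectors lying on the line represented by the bivector `w`. -/
def lineSub (w : Fin 6 → K) : Submodule K (Fin 4 → K) := LinearMap.ker (wedgeMap w)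

theorem mem_lineSub {w : Fin 6 → K} {v : Fin 4 → K} : v ∈ lineSub w ↔ wedgePt w v = 0 :=
  Iff.rfl

theorem lineSub_smul {t : K} (ht : t ≠ 0) (w : Fin 6 → K) : lineSub (t • w) = lineSub w := by
  ext v
  simp only [lineSub, LinearMap.mem_ker, map_smul, LinearMap.smul_apply, smul_eq_zero, ht,
    false_or]

theorem mem_lineOfRep {w : Fin 6 → K} {p : PP K 4} : p ∈ lineOfRep w ↔ p.rep ∈ lineSub w := by
  refine ⟨fun h => h _ p.rep_nonzero p.mk_rep, fun h v hv hp => ?_⟩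
  obtain ⟨t, -, rfl⟩ := exists_smul_rep_eq hp
  exact (lineSub w).smul_mem t h

theorem mem_lineOf {x : PP K 6} {p : PP K 4} : p ∈ lineOf x ↔ p.rep ∈ lineSub x.rep := by
  refine ⟨fun h => mem_lineOfRep.mp (h _ x.rep_nonzero x.mk_rep), fun h w hw hx => ?_⟩
  obtain ⟨t, ht, rfl⟩ := exists_smul_rep_eq hx
  rwa [mem_lineOfRep, lineSub_smul ht]

theorem isLineRep_rep {x : PP K 6} (hx : x ∈ grass K) : IsLineRep x.rep := by
  obtain ⟨w, hw, hwx, hq⟩ := hx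
  obtain ⟨t, ht, rfl⟩ := exists_smul_rep_eq hwx
  refine ⟨x.rep_nonzero, ?_⟩
  have : t * t * plQuad x.rep = 0 := by
    rw [← hq]
    simp only [plQuad, Pi.smul_apply, smul_eq_mul]
    ring
  simpa [ht] using this

theorem exists_plucker_eq_smul {w : Fin 6 → K} (hw : IsLineRep w) :
    ∃ (a b : Fin 4 → K) (c : K), c ≠ 0 ∧ plucker a b = c • w := by
  obtain ⟨hne, hq⟩ := hw
  simp only [plQuad] at hq
  obtain ⟨i, hi⟩ := Function.ne_iff.mp hne
  fin_cases i
  · refine ⟨![w 0, 0, -w 3, -w 4], ![0, w 0, w 1, w 2], w 0, hi, ?_⟩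
    ext j; fin_cases j <;> simp [plucker] <;> grind
  · refine ⟨![w 1, w 3, 0, -w 5], ![0, w 0, w 1, w 2], w 1, hi, ?_⟩
    ext j; fin_cases j <;> simp [plucker] <;> grind
  · refine ⟨![w 2, w 4, w 5, 0], ![0, w 0, w 1, w 2], w 2, hi, ?_⟩
    ext j; fin_cases j <;> simp [plucker] <;> grind
  · refine ⟨![w 1, w 3, 0, -w 5], ![-w 0, 0, w 3, w 4], w 3, hi, ?_⟩
    ext j; fin_cases j <;> simp [plucker] <;> grind
  · refine ⟨![w 2, w 4, w 5, 0], ![-w 0, 0, w 3, w 4], w 4, hi, ?_⟩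
    ext j; fin_cases j <;> simp [plucker] <;> grind
  · refine ⟨![w 2, w 4, w 5, 0], ![-w 1, -w 3, 0, w 5], w 5, hi, ?_⟩
    ext j; fin_cases j <;> simp [plucker] <;> grind

theorem plucker_comb (a b : Fin 4 → K) (s t s' t' : K) :
    plucker (s • a + t • b) (s' • a + t' • b) = (s * t' - t * s') • plucker a b := by
  ext j; fin_cases j <;> simp [plucker] <;> ring

theorem plucker_ne_zero_iff {a b : Fin 4 → K} :
    plucker a b ≠ 0 ↔ LinearIndependent K ![a, b] := by
  rw [LinearIndependent.pair_iff]
  constructor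
  · intro h s t hst
    have h1 := plucker_comb a b s t 0 1
    have h2 := plucker_comb a b s t 1 0
    have hz : ∀ c, plucker (0 : Fin 4 → K) c = 0 := fun c => by
      ext j; fin_cases j <;> simp [plucker]
    rw [hst, hz] at h1 h2
    simp only [mul_one, mul_zero, sub_zero, zero_sub] at h1 h2
    have h1' := (smul_eq_zero.mp h1.symm).resolve_right h
    have h2' := (smul_eq_zero.mp h2.symm).resolve_right h
    exact ⟨h1', by simpa using h2'⟩
  · intro h hp
    have hij : ∀ i j, a i * b j - a j * b i = 0 := by
      have e : ∀ k, plucker a b k = 0 := fun k => congrFun hp k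
      have e0 := e 0
      have e1 := e 1
      have e2 := e 2
      have e3 := e 3
      have e4 := e 4
      have e5 := e 5
      simp [plucker] at e0 e1 e2 e3 e4 e5
      intro i j
      fin_cases i <;> fin_cases j <;> simp <;> grind
    have ha : ∀ i, a i = 0 := fun i => by
      have := (h (b i) (-a i) (by ext j; simp; linear_combination -(hij i j))).2
      simpa using this
    have := (h 1 0 (by ext i; simp [ha i])).1
    exact one_ne_zero this

theorem lineSub_plucker {a b : Fin 4 → K} (h : plucker a b ≠ 0) :
    lineSub (plucker a b) = Submodule.span K {a, b} := by
  refine le_antisymm (fun v hv => ?_) ?_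
  · rw [Submodule.mem_span_pair]
    rw [mem_lineSub] at hv
    have e0 := congrFun hv 0
    have e1 := congrFun hv 1
    have e2 := congrFun hv 2
    have e3 := congrFun hv 3
    simp [plucker, wedgePt] at e0 e1 e2 e3
    have key : ∀ i j, a i * b j - a j * b i ≠ 0 → ∃ s t : K, s • a + t • b = v := by
      intro i j hij
      refine ⟨(v i * b j - v j * b i) / (a i * b j - a j * b i),
        (a i * v j - a j * v i) / (a i * b j - a j * b i), ?_⟩
      ext k
      simp only [Pi.add_apply, Pi.smul_apply, smul_eq_mul]
      rw [div_mul_eq_mul_div, div_mul_eq_mul_div, ← add_div, div_eq_iff hij]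
      clear hij hv h
      fin_cases i <;> fin_cases j <;> fin_cases k <;> simp <;> grind
    obtain ⟨i, hi⟩ := Function.ne_iff.mp h
    fin_cases i
    exacts [key 0 1 hi, key 0 2 hi, key 0 3 hi, key 1 2 hi, key 1 3 hi, key 2 3 hi]
  · rw [Submodule.span_le]
    rintro v (rfl | rfl) <;> rw [SetLike.mem_coe, mem_lineSub] <;> ext j <;> fin_cases j <;>
      simp [plucker, wedgePt] <;> ring

theorem exists_basis_lineSub {w : Fin 6 → K} (hw : IsLineRep w) :
    ∃ (a b : Fin 4 → K) (c : K), c ≠ 0 ∧ plucker a b = c • w ∧ LinearIndependent K ![a, b] ∧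
      lineSub w = Submodule.span K {a, b} := by
  obtain ⟨a, b, c, hc, h⟩ := exists_plucker_eq_smul hw
  have hne : plucker a b ≠ 0 := by rw [h]; exact smul_ne_zero hc hw.1
  exact ⟨a, b, c, hc, h, plucker_ne_zero_iff.mp hne, by
    rw [← lineSub_plucker hne, h, lineSub_smul hc]⟩

theorem finrank_span_pair {V : Type*} [AddCommGroup V] [Module K V] {a b : V}
    (h : LinearIndependent K ![a, b]) : Module.finrank K (Submodule.span K {a, b}) = 2 := by
  have := finrank_span_eq_card h
  rwa [Matrix.range_cons, Matrix.range_cons, Matrix.range_empty, Set.union_empty,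
    Set.singleton_union, Fintype.card_fin] at this

theorem finrank_lineSub {w : Fin 6 → K} (hw : IsLineRep w) :
    Module.finrank K (lineSub w) = 2 := by
  obtain ⟨a, b, -, -, -, hli, hspan⟩ := exists_basis_lineSub hw
  rw [hspan, finrank_span_pair hli]

theorem isLineRep_plucker {a b : Fin 4 → K} (h : LinearIndependent K ![a, b]) :
    IsLineRep (plucker a b) :=
  ⟨plucker_ne_zero_iff.mpr h, by simp [plQuad, plucker]; ring⟩

theorem eq_of_lineSub_eq {x y : PP K 6} (hx : x ∈ grass K) (hy : y ∈ grass K)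
    (h : lineSub x.rep = lineSub y.rep) : x = y := by
  obtain ⟨a, b, c, hc, hab, -, hspan⟩ := exists_basis_lineSub (isLineRep_rep hx)
  obtain ⟨a', b', c', hc', hab', -, hspan'⟩ := exists_basis_lineSub (isLineRep_rep hy)
  have ha' : a' ∈ Submodule.span K {a, b} := by
    rw [← hspan, h, hspan']
    exact Submodule.subset_span (by simp)
  have hb' : b' ∈ Submodule.span K {a, b} := by
    rw [← hspan, h, hspan']
    exact Submodule.subset_span (by simp)
  obtain ⟨s, t, rfl⟩ := Submodule.mem_span_pair.mp ha'
  obtain ⟨s', t', rfl⟩ := Submodule.mem_span_pair.mp hb'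
  rw [plucker_comb, hab] at hab'
  rw [← x.mk_rep, ← y.mk_rep, eq_comm, Projectivization.mk_eq_mk_iff']
  refine ⟨c'⁻¹ * ((s * t' - t * s') * c), ?_⟩
  rw [mul_smul, mul_smul, hab', inv_smul_smul₀ hc']

/-! ### The wedge pairing -/

/-- The wedge pairing as a bilinear form. -/
def plForm : LinearMap.BilinForm K (Fin 6 → K) :=
  LinearMap.mk₂ K plPair
    (fun w w' v => by simp [plPair]; ring)
    (fun c w v => by simp [plPair]; ring)
    (fun w v v' => by simp [plPair]; ring)
    (fun c w v => by simp [plPair]; ring)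

theorem plPair_comm (w z : Fin 6 → K) : plPair w z = plPair z w := by
  simp only [plPair]; ring

theorem plPair_self (w : Fin 6 → K) : plPair w w = 2 * plQuad w := by
  simp only [plPair, plQuad]; ring

theorem plQuad_comb (w z : Fin 6 → K) (s t : K) :
    plQuad (s • w + t • z) = s * s * plQuad w + t * t * plQuad z + s * t * plPair w z := by
  simp only [plQuad, plPair, Pi.add_apply, Pi.smul_apply, smul_eq_mul]; ring

theorem plPair_smul_smul (s t : K) (w z : Fin 6 → K) :
    plPair (s • w) (t • z) = s * t * plPair w z := by
  simp only [plPair, Pi.smul_apply, smul_eq_mul]; ring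

theorem plPair_plucker (a b c d : Fin 4 → K) :
    plPair (plucker a b) (plucker c d) = Matrix.det (Matrix.of ![a, b, c, d]) := by
  simp [plPair, plucker, Matrix.det_succ_row_zero, Fin.sum_univ_succ, Fin.succAbove]
  ring

theorem plPair_eq_zero_iff {w z : Fin 6 → K} (hw : IsLineRep w) (hz : IsLineRep z) :
    plPair w z = 0 ↔ ∃ v ≠ 0, v ∈ lineSub w ∧ v ∈ lineSub z := by
  obtain ⟨a, b, s, hs, hab, hli, hspan⟩ := exists_basis_lineSub hw
  obtain ⟨c, d, t, ht, hcd, hli', hspan'⟩ := exists_basis_lineSub hz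
  have hdet : plPair w z = 0 ↔ Matrix.det (Matrix.of ![a, b, c, d]) = 0 := by
    rw [← plPair_plucker, hab, hcd, plPair_smul_smul]
    simp [hs, ht]
  rw [hdet, ← Matrix.exists_vecMul_eq_zero_iff, hspan, hspan']
  have hmul : ∀ g : Fin 4 → K, Matrix.vecMul g (Matrix.of ![a, b, c, d]) =
      g 0 • a + g 1 • b + (g 2 • c + g 3 • d) := by
    intro g
    ext i
    simp [Matrix.vecMul, dotProduct, Fin.sum_univ_four]
    ring
  rw [LinearIndependent.pair_iff] at hli hli'
  constructor
  · rintro ⟨g, hg, hgM⟩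
    rw [hmul] at hgM
    refine ⟨g 0 • a + g 1 • b, fun h0 => hg ?_, Submodule.mem_span_pair.mpr ⟨_, _, rfl⟩,
      Submodule.mem_span_pair.mpr ⟨-g 2, -g 3, ?_⟩⟩
    · rw [h0, zero_add] at hgM
      obtain ⟨h0, h1⟩ := hli _ _ h0
      obtain ⟨h2, h3⟩ := hli' _ _ hgM
      ext i; fin_cases i <;> assumption
    · rw [eq_neg_of_add_eq_zero_left hgM]
      module
  · rintro ⟨v, hv, h1, h2⟩
    obtain ⟨p, q, rfl⟩ := Submodule.mem_span_pair.mp h1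
    obtain ⟨r, u, h⟩ := Submodule.mem_span_pair.mp h2
    refine ⟨![p, q, -r, -u], fun h0 => hv ?_, ?_⟩
    · have hp : p = 0 := congrFun h0 0
      have hq : q = 0 := congrFun h0 1
      simp [hp, hq]
    · rw [hmul]
      simp only [Matrix.cons_val]
      rw [← h]
      module

/-! ### Closed incidence conditions -/

theorem zClosed_lineOf (x : PP K 6) : ZClosed (lineOf x) := by
  have h : lineOf x = {p : PP K 4 | wedgeMap x.rep p.rep = 0} := Set.ext fun p => mem_lineOf
  rw [h]
  exact zClosed_setOf_linear _

theorem zClosed_linesThrough (q : Fin 4 → K) : ZClosed {x : PP K 6 | q ∈ lineSub x.rep} :=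
  zClosed_setOf_linear (wedgeMap.flip q)

theorem mem_hyp {n : ℕ} {φ : Fin n → K} {x : PP K n} : x ∈ hyp φ ↔ ∑ i, φ i * x.rep i = 0 := by
  refine ⟨fun h => h _ x.rep_nonzero x.mk_rep, fun h v hv hx => ?_⟩
  obtain ⟨t, -, rfl⟩ := exists_smul_rep_eq hx
  simp only [Pi.smul_apply, smul_eq_mul, mul_left_comm _ t, ← Finset.mul_sum, h, mul_zero]

/-- The coefficients of the linear form `z ↦ w ∧ z`. -/
def plDual (w : Fin 6 → K) : Fin 6 → K := ![w 5, -w 4, w 3, w 2, -w 1, w 0]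

theorem mem_hyp_plDual {w : Fin 6 → K} {x : PP K 6} :
    x ∈ hyp (plDual w) ↔ plPair w x.rep = 0 := by
  rw [mem_hyp]
  refine Eq.congr_left ?_
  simp [plDual, plPair, Fin.sum_univ_six]
  ring

theorem plDual_ne_zero {w : Fin 6 → K} (hw : w ≠ 0) : plDual w ≠ 0 := by
  intro h
  apply hw
  have e := fun i => congrFun h i
  have e0 := e 0
  have e1 := e 1
  have e2 := e 2
  have e3 := e 3
  have e4 := e 4
  have e5 := e 5
  simp [plDual] at e0 e1 e2 e3 e4 e5
  ext i
  fin_cases i <;> assumption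

theorem zClosed_hyp {n : ℕ} (φ : Fin n → K) : ZClosed (hyp φ) := by
  have h : hyp φ = {x : PP K n |
      (LinearMap.pi fun _ : Fin 1 => ∑ i, φ i • LinearMap.proj (R := K) i) x.rep = 0} := by
    ext x
    rw [mem_hyp, Set.mem_ofPred_eq, funext_iff]
    simp
  rw [h]
  exact zClosed_setOf_linear _

/-- The matrix of linear forms in `w` describing `v ↦ w ∧ v`. -/
noncomputable def wedgeMatrix : Fin 4 → Fin 4 → MvPolynomial (Fin 6) K :=
  ![![X 3, -X 1, X 0, 0], ![X 4, -X 2, 0, X 0], ![X 5, 0, -X 2, X 1], ![0, X 5, -X 4, X 3]]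

theorem wedgeMatrix_isHomogeneous (i j : Fin 4) :
    (wedgeMatrix i j : MvPolynomial (Fin 6) K).IsHomogeneous 1 := by
  fin_cases i <;> fin_cases j <;> simp only [wedgeMatrix] <;>
    first
    | exact isHomogeneous_X K _
    | exact (isHomogeneous_X K _).neg
    | exact isHomogeneous_zero _ _ _

theorem sum_wedgeMatrix_eq_zero_iff {w : Fin 6 → K} {v : Fin 4 → K} :
    (∀ j, ∑ l, v l * eval w (wedgeMatrix j l) = 0) ↔ v ∈ lineSub w := by
  rw [mem_lineSub, funext_iff]
  refine forall_congr' fun j => Eq.congr_left ?_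
  fin_cases j <;> simp [wedgeMatrix, wedgePt, Fin.sum_univ_four] <;> ring

/-- The union of the lines of a closed family is closed. -/
theorem zClosed_sweep [IsAlgClosed K] {C : Set (PP K 6)} (hC : ZClosed C) :
    ZClosed {p : PP K 4 | ∃ x ∈ C, p ∈ lineOf x} := by
  obtain ⟨T, hT, hCT⟩ := hC
  refine zClosed_of_forall_notMem fun p hp => ?_
  obtain ⟨b, hbp, hb⟩ := exists_separating_polynomial hT (v₀ := p.rep)
    wedgeMatrix_isHomogeneous <| by
    intro w hwT hwp
    by_contra hw
    refine hp ⟨Projectivization.mk K w hw, ?_, ?_⟩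
    · rw [hCT]
      intro f hf v hv hvw
      obtain ⟨d, hd⟩ := hT f hf
      obtain ⟨a, rfl⟩ := (Projectivization.mk_eq_mk_iff' K _ _ _ _).mp hvw
      rw [eval_smul_of_isHomogeneous hd, hwT f hf, mul_zero]
    · intro z hz hzw
      obtain ⟨a, rfl⟩ := (Projectivization.mk_eq_mk_iff' K _ _ _ _).mp hzw
      rw [mem_lineOfRep, lineSub_smul (left_ne_zero_of_smul hz)]
      exact sum_wedgeMatrix_eq_zero_iff.mp hwp
  obtain ⟨i, hi⟩ : ∃ i, eval p.rep (homogeneousComponent i b) ≠ 0 := by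
    by_contra! h
    rw [← sum_homogeneousComponent b, map_sum] at hbp
    exact hbp (Finset.sum_eq_zero fun i _ => h i)
  refine ⟨homogeneousComponent i b, ⟨i, homogeneousComponent_isHomogeneous _ _⟩, ?_, hi⟩
  rintro y ⟨x, hx, hyx⟩
  refine eval_homogeneousComponent_eq_zero (fun t => ?_) i
  refine hb _ x.rep x.rep_nonzero (fun f hf => ?_)
    (sum_wedgeMatrix_eq_zero_iff.mpr ((lineSub x.rep).smul_mem t (mem_lineOf.mp hyx)))
  rw [hCT] at hx
  exact hx f hf _ x.rep_nonzero x.mk_rep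

/-! ### Configurations of lines -/

theorem linearIndependent_rep_pair {n : ℕ} {p q : PP K n} (h : p ≠ q) :
    LinearIndependent K ![p.rep, q.rep] := by
  rw [LinearIndependent.pair_iff' p.rep_nonzero]
  intro a ha
  apply h
  rw [← p.mk_rep, ← q.mk_rep, eq_comm, Projectivization.mk_eq_mk_iff']
  exact ⟨a, ha⟩

theorem lineSub_eq_span_pair {w : Fin 6 → K} (hw : IsLineRep w) {a b : Fin 4 → K}
    (h : LinearIndependent K ![a, b]) (ha : a ∈ lineSub w) (hb : b ∈ lineSub w) :
    lineSub w = Submodule.span K {a, b} := by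
  refine (Submodule.eq_of_le_of_finrank_eq (Submodule.span_le.mpr ?_) ?_).symm
  · rintro v (rfl | rfl) <;> assumption
  · rw [finrank_span_pair h, finrank_lineSub hw]

theorem exists_smul_eq_of_mem_of_mem {w z : Fin 6 → K} (hw : IsLineRep w) (hz : IsLineRep z)
    (hne : lineSub w ≠ lineSub z) {q v : Fin 4 → K} (hq : q ≠ 0) (hqw : q ∈ lineSub w)
    (hqz : q ∈ lineSub z) (hvw : v ∈ lineSub w) (hvz : v ∈ lineSub z) : ∃ t : K, t • q = v := by
  by_contra! h
  have hli := (LinearIndependent.pair_iff' hq).mpr h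
  exact hne ((lineSub_eq_span_pair hw hli hqw hvw).trans (lineSub_eq_span_pair hz hli hqz hvz).symm)

theorem finrank_sup_lineSub {w z : Fin 6 → K} (hw : IsLineRep w) (hz : IsLineRep z)
    (hne : lineSub w ≠ lineSub z) {q : Fin 4 → K} (hq : q ≠ 0) (hqw : q ∈ lineSub w)
    (hqz : q ∈ lineSub z) : Module.finrank K (lineSub w ⊔ lineSub z : Submodule K _) = 3 := by
  have hinf : lineSub w ⊓ lineSub z = Submodule.span K {q} := by
    refine le_antisymm (fun v hv => ?_) ?_
    · exact Submodule.mem_span_singleton.mpr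
        (exists_smul_eq_of_mem_of_mem hw hz hne hq hqw hqz hv.1 hv.2)
    · rw [Submodule.span_singleton_le_iff_mem]
      exact ⟨hqw, hqz⟩
  have h := Submodule.finrank_sup_add_finrank_inf_eq (lineSub w) (lineSub z)
  rw [hinf, finrank_span_singleton hq, finrank_lineSub hw, finrank_lineSub hz] at h
  omega

/-- A line meeting two lines which meet at `q` passes through `q` or lies in their plane. -/
theorem mem_or_le_sup_of_plPair_eq_zero {w z u : Fin 6 → K} (hw : IsLineRep w) (hz : IsLineRep z)
    (hu : IsLineRep u) (hne : lineSub w ≠ lineSub z) {q : Fin 4 → K} (hq : q ≠ 0)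
    (hqw : q ∈ lineSub w) (hqz : q ∈ lineSub z) (huw : plPair w u = 0) (huz : plPair z u = 0) :
    q ∈ lineSub u ∨ lineSub u ≤ lineSub w ⊔ lineSub z := by
  obtain ⟨a, ha, haw, hau⟩ := (plPair_eq_zero_iff hw hu).mp huw
  obtain ⟨b, hb, hbz, hbu⟩ := (plPair_eq_zero_iff hz hu).mp huz
  by_cases hli : LinearIndependent K ![a, b]
  · right
    rw [lineSub_eq_span_pair hu hli hau hbu, Submodule.span_le]
    rintro v (rfl | rfl)
    · exact Submodule.mem_sup_left haw
    · exact Submodule.mem_sup_right hbz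
  · left
    rw [LinearIndependent.pair_iff' ha] at hli
    push Not at hli
    obtain ⟨t, rfl⟩ := hli
    have ht : t ≠ 0 := left_ne_zero_of_smul hb
    have haz : a ∈ lineSub z := (Submodule.smul_mem_iff _ ht).mp hbz
    obtain ⟨s, rfl⟩ := exists_smul_eq_of_mem_of_mem hw hz hne hq hqw hqz haw haz
    exact (Submodule.smul_mem_iff _ (left_ne_zero_of_smul ha)).mp hau

/-- Two coplanar lines meet. -/
theorem plPair_eq_zero_of_le {w z : Fin 6 → K} (hw : IsLineRep w) (hz : IsLineRep z)
    {H : Submodule K (Fin 4 → K)} (hH : Module.finrank K H = 3) (hwH : lineSub w ≤ H)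
    (hzH : lineSub z ≤ H) : plPair w z = 0 := by
  rw [plPair_eq_zero_iff hw hz]
  have h := Submodule.finrank_sup_add_finrank_inf_eq (lineSub w) (lineSub z)
  have h' := Submodule.finrank_mono (sup_le hwH hzH)
  rw [finrank_lineSub hw, finrank_lineSub hz] at h
  obtain ⟨v, hv, hv0⟩ := Submodule.exists_mem_ne_zero_of_ne_bot
    (p := lineSub w ⊓ lineSub z) fun h0 => by
      rw [h0, finrank_bot] at h
      omega
  exact ⟨v, hv0, hv.1, hv.2⟩

theorem infinite_lineOf [Infinite K] {x : PP K 6} (hx : x ∈ grass K) : (lineOf x).Infinite := by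
  obtain ⟨a, b, -, -, -, hli, hspan⟩ := exists_basis_lineSub (isLineRep_rep hx)
  rw [LinearIndependent.pair_iff] at hli
  have hne : ∀ t : K, a + t • b ≠ 0 := fun t h0 =>
    one_ne_zero (hli 1 t (by rw [one_smul, h0])).1
  refine Set.infinite_of_injective_forall_mem
    (f := fun t : K => Projectivization.mk K (a + t • b) (hne t)) (fun t t' h => ?_) fun t => ?_
  · obtain ⟨c, hc⟩ := (Projectivization.mk_eq_mk_iff' K _ _ _ _).mp h
    obtain ⟨h1, h2⟩ := hli (c - 1) (c * t' - t) (by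
      rw [← sub_eq_zero] at hc
      rw [← hc]
      module)
    grind
  · rw [mem_lineOf, hspan, Submodule.mem_span_pair]
    obtain ⟨c, hc⟩ := Projectivization.exists_smul_eq_mk_rep K (a + t • b) (hne t)
    exact ⟨c, c * t, by rw [← hc, Units.smul_def]; module⟩

theorem linearIndependent_of_pairwise_skew {w : Fin 3 → Fin 6 → K} (hw : ∀ i, plQuad (w i) = 0)
    (h : ∀ i j, i ≠ j → plPair (w i) (w j) ≠ 0) : LinearIndependent K w := by
  rw [Fintype.linearIndependent_iff]
  intro g hg
  rw [Fin.sum_univ_three] at hg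
  have hpair : ∀ z, g 0 * plPair (w 0) z + g 1 * plPair (w 1) z + g 2 * plPair (w 2) z = 0 := by
    intro z
    have := congrArg (fun u => plForm u z) hg
    simp only [map_add, map_smul, LinearMap.add_apply, LinearMap.smul_apply, smul_eq_mul, map_zero,
      LinearMap.zero_apply] at this
    exact this
  have hquad : g 0 * g 1 * plPair (w 0) (w 1) = 0 := by
    have h2 : g 0 • w 0 + g 1 • w 1 = (-g 2) • w 2 + (0 : K) • w 2 := by
      rw [eq_neg_of_add_eq_zero_left hg]
      module
    have h3 := plQuad_comb (w 0) (w 1) (g 0) (g 1)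
    rw [h2, plQuad_comb, hw, hw, hw] at h3
    linear_combination -h3
  have h01 := h 0 1 (by decide)
  have h02 := h 0 2 (by decide)
  have h12 := h 1 2 (by decide)
  have p0 := hpair (w 0)
  have p1 := hpair (w 1)
  have p2 := hpair (w 2)
  rw [plPair_self, hw, plPair_comm (w 1), plPair_comm (w 2)] at p0
  rw [plPair_self, hw, plPair_comm (w 2)] at p1
  rw [plPair_self, hw] at p2
  have : g 0 = 0 ∨ g 1 = 0 := by simpa [h01] using hquad
  have h0 : g 0 = 0 := by grind
  have h1 : g 1 = 0 := by grind
  have h2 : g 2 = 0 := by grind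
  intro i
  fin_cases i <;> assumption

theorem plForm_nondegenerate : (plForm (K := K)).Nondegenerate := by
  have hsep : ∀ w : Fin 6 → K, (∀ z, plForm w z = 0) → w = 0 := by
    intro w h
    have e : ∀ i, plPair w (Pi.single i 1) = 0 := fun i => h _
    have e0 := e 0
    have e1 := e 1
    have e2 := e 2
    have e3 := e 3
    have e4 := e 4
    have e5 := e 5
    simp [plPair] at e0 e1 e2 e3 e4 e5
    ext i
    fin_cases i <;> assumption
  exact ⟨hsep, fun z h => hsep z fun w => (plPair_comm z w).trans (h w)⟩

/-- Three independent bivectors orthogonal to three independent bivectors span the orthogonal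
complement of the latter. -/
theorem mem_span_of_orthogonal {w z : Fin 3 → Fin 6 → K} (hw : LinearIndependent K w)
    (hz : LinearIndependent K z) (hwz : ∀ i j, plPair (w i) (z j) = 0) {y : Fin 6 → K}
    (hy : ∀ i, plPair (w i) y = 0) : y ∈ Submodule.span K (Set.range z) := by
  have hmem : ∀ u, (∀ i, plPair (w i) u = 0) →
      u ∈ plForm.orthogonal (Submodule.span K (Set.range w)) := by
    intro u hu
    rw [LinearMap.BilinForm.mem_orthogonal_iff]
    intro v hv
    have hle : Submodule.span K (Set.range w) ≤ LinearMap.ker (plForm.flip u) := by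
      rw [Submodule.span_le]
      rintro _ ⟨i, rfl⟩
      exact hu i
    exact hle hv
  have hfin := LinearMap.BilinForm.finrank_orthogonal plForm_nondegenerate
    (Submodule.span K (Set.range w))
  rw [finrank_span_eq_card hw, Module.finrank_fin_fun, Fintype.card_fin] at hfin
  have heq : Submodule.span K (Set.range z) = plForm.orthogonal (Submodule.span K (Set.range w)) := by
    refine Submodule.eq_of_le_of_finrank_eq (Submodule.span_le.mpr ?_) ?_
    · rintro _ ⟨j, rfl⟩
      exact hmem _ fun i => hwz i j
    · rw [finrank_span_eq_card hz, Fintype.card_fin, hfin]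
  rw [heq]
  exact hmem y hy

/-- Two distinct transversals of three pairwise skew lines are skew. -/
theorem plPair_ne_zero_of_transversals {w : Fin 3 → Fin 6 → K} (hw : ∀ i, IsLineRep (w i))
    (hskew : ∀ i j, i ≠ j → plPair (w i) (w j) ≠ 0) {z z' : Fin 6 → K} (hz : IsLineRep z)
    (hz' : IsLineRep z') (hne : lineSub z ≠ lineSub z') (h : ∀ i, plPair (w i) z = 0)
    (h' : ∀ i, plPair (w i) z' = 0) : plPair z z' ≠ 0 := by
  intro h0
  obtain ⟨q, hq, hqz, hqz'⟩ := (plPair_eq_zero_iff hz hz').mp h0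
  have hH := finrank_sup_lineSub hz hz' hne hq hqz hqz'
  have hpt : ∀ i j, i ≠ j → q ∈ lineSub (w i) → q ∉ lineSub (w j) := fun i j hij hi hj =>
    hskew i j hij ((plPair_eq_zero_iff (hw i) (hw j)).mpr ⟨q, hq, hi, hj⟩)
  have hpl : ∀ i j, i ≠ j → lineSub (w i) ≤ lineSub z ⊔ lineSub z' →
      ¬ lineSub (w j) ≤ lineSub z ⊔ lineSub z' := fun i j hij hi hj =>
    hskew i j hij (plPair_eq_zero_of_le (hw i) (hw j) hH hi hj)
  have hor := fun i => mem_or_le_sup_of_plPair_eq_zero hz hz' (hw i) hne hq hqz hqz'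
    ((plPair_comm _ _).trans (h i)) ((plPair_comm _ _).trans (h' i))
  rcases hor 0 with h0 | h0 <;> rcases hor 1 with h1 | h1 <;> rcases hor 2 with h2 | h2
  · exact hpt 0 1 (by decide) h0 h1
  · exact hpt 0 1 (by decide) h0 h1
  · exact hpt 0 2 (by decide) h0 h2
  · exact hpl 1 2 (by decide) h1 h2
  · exact hpt 1 2 (by decide) h1 h2
  · exact hpl 0 2 (by decide) h0 h2
  · exact hpl 0 1 (by decide) h0 h1
  · exact hpl 0 1 (by decide) h0 h1

/-! ### Lines on a ruled surface -/

/-- A surface of degree at least two is not a line. -/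
theorem HasSurfDeg.not_subset_lineOf {S : Set (PP K 4)} {d : ℕ} (hd : 2 ≤ d)
    (hdeg : HasSurfDeg S d) {x : PP K 6} (hx : x ∈ linesOf S) : ¬ S ⊆ lineOf x := by
  intro hS
  obtain ⟨-, w, hw, hwS, hcard⟩ := hdeg
  obtain ⟨p, q, hp, hq, hpq⟩ := (Set.one_lt_ncard_iff
    (Set.finite_of_ncard_pos (by omega))).mp (by omega : 1 < (S ∩ lineOfRep w).ncard)
  have hli := linearIndependent_rep_pair hpq
  have h1 := lineSub_eq_span_pair hw hli (mem_lineOfRep.mp hp.2) (mem_lineOfRep.mp hq.2)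
  have h2 := lineSub_eq_span_pair (isLineRep_rep hx.1) hli (mem_lineOf.mp (hS hp.1))
    (mem_lineOf.mp (hS hq.1))
  refine hwS fun r hr => hx.2 ?_
  rw [mem_lineOf, h2, ← h1]
  exact mem_lineOfRep.mp hr

/-- A closed family of lines containing all but finitely many lines of a ruled surface
covers the surface. -/
theorem exists_mem_lineOf_of_cofinite [IsAlgClosed K] {S : Set (PP K 4)} {d : ℕ} (hd : 2 ≤ d)
    (hruled : IsRuled S) (hdeg : HasSurfDeg S d) {C : Set (PP K 6)} (hCcl : ZClosed C)
    (hfin : (linesOf S \ C).Finite) {p : PP K 4} (hp : p ∈ S) : ∃ y ∈ C, p ∈ lineOf y := by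
  have hsweep := zClosed_sweep hCcl
  have hlines : ZClosed (⋃ x ∈ linesOf S \ C, lineOf x) :=
    ZClosed.biUnion hfin fun x _ => zClosed_lineOf x
  have hcov : S ⊆ {p : PP K 4 | ∃ x ∈ C, p ∈ lineOf x} ∪ ⋃ x ∈ linesOf S \ C, lineOf x := by
    intro r hr
    obtain ⟨x, hx, hrx⟩ := hruled.2.2.2 r hr
    by_cases hxC : x ∈ C
    · exact Or.inl ⟨x, hxC, hrx⟩
    · exact Or.inr (Set.mem_biUnion ⟨hx, hxC⟩ hrx)
  rcases hruled.2.1.2 _ _ hsweep hlines hcov with h | h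
  · exact h hp
  · obtain ⟨x, hx, hSx⟩ := hruled.2.1.exists_subset_of_finite hfin
      (fun x _ => zClosed_lineOf x) h
    exact absurd hSx (hdeg.not_subset_lineOf hd hx.1)

/-- An isolated line meets all lines of the curve `C`. -/
theorem plPair_eq_zero_of_isolated [Infinite K] {S : Set (PP K 4)} {d : ℕ} {C : Set (PP K 6)}
    (hCsub : C ⊆ linesOf S) (hCdeg : HasCurveDeg C d)
    (hcov : ∀ p ∈ S, ∃ y ∈ C, p ∈ lineOf y) {x : PP K 6} (hx : x ∈ linesOf S \ C) {y : PP K 6}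
    (hy : y ∈ C) : plPair x.rep y.rep = 0 := by
  by_contra hxy
  have hfinite := (hCdeg.1 (plDual x.rep) (plDual_ne_zero x.rep_nonzero)
    fun h => hxy (mem_hyp_plDual.mp (h hy))).1
  have hxl := isLineRep_rep hx.1.1
  choose! f hfC hf using fun p (hp : p ∈ lineOf x) => hcov p (hx.1.2 hp)
  refine (infinite_lineOf hx.1.1) (Set.Finite.of_injOn (f := f) (fun p hp => ?_)
    (fun p hp q hq hpq => ?_) hfinite)
  · refine ⟨hfC p hp, mem_hyp_plDual.mpr ?_⟩
    rw [plPair_eq_zero_iff hxl (isLineRep_rep (hCsub (hfC p hp)).1)]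
    exact ⟨p.rep, p.rep_nonzero, mem_lineOf.mp hp, mem_lineOf.mp (hf p hp)⟩
  · by_contra hne
    have hli := linearIndependent_rep_pair hne
    have hfl := hCsub (hfC p hp)
    have hqf : q.rep ∈ lineSub (f p).rep := by
      rw [hpq]
      exact mem_lineOf.mp (hf q hq)
    have h1 := lineSub_eq_span_pair hxl hli (mem_lineOf.mp hp) (mem_lineOf.mp hq)
    have h2 := lineSub_eq_span_pair (isLineRep_rep hfl.1) hli (mem_lineOf.mp (hf p hp)) hqf
    have hxf := eq_of_lineSub_eq hx.1.1 hfl.1 (h1.trans h2.symm)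
    exact hx.2 (hxf ▸ hfC p hp)

/-- The lines of an irreducible family covering a surface of degree at least two are not all
contained in a plane. -/
theorem not_forall_lineSub_le {S : Set (PP K 4)} {d : ℕ} (hd : 2 ≤ d) (hdeg : HasSurfDeg S d)
    {C : Set (PP K 6)} (hCsub : C ⊆ linesOf S) (hCirr : ZIrred C)
    (hcov : ∀ p ∈ S, ∃ y ∈ C, p ∈ lineOf y) {H : Submodule K (Fin 4 → K)}
    (hH : Module.finrank K H = 3) : ¬ ∀ y ∈ C, lineSub y.rep ≤ H := by
  intro hCH
  obtain ⟨hle, w, hw, hwS, hcard⟩ := hdeg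
  have hfinite := (hle w hw hwS).1
  have hSH : ∀ p ∈ S, p.rep ∈ H := fun p hp => by
    obtain ⟨y, hy, hpy⟩ := hcov p hp
    exact hCH y hy (mem_lineOf.mp hpy)
  have hcard' : 1 < (S ∩ lineOfRep w).ncard := by omega
  obtain ⟨p, q, hp, hq, hpq⟩ := (Set.one_lt_ncard_iff hfinite).mp hcard'
  have hwH : lineSub w ≤ H := by
    rw [lineSub_eq_span_pair hw (linearIndependent_rep_pair hpq) (mem_lineOfRep.mp hp.2)
      (mem_lineOfRep.mp hq.2), Submodule.span_le]
    rintro v (rfl | rfl)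
    · exact hSH p hp.1
    · exact hSH q hq.1
  have hCcov : C ⊆ ⋃ r ∈ S ∩ lineOfRep w, {x : PP K 6 | r.rep ∈ lineSub x.rep} := by
    intro y hy
    have hyl := isLineRep_rep (hCsub hy).1
    obtain ⟨v, hv, hvy, hvw⟩ := (plPair_eq_zero_iff hyl hw).mp
      (plPair_eq_zero_of_le hyl hw hH (hCH y hy) hwH)
    obtain ⟨t, ht, hrep⟩ := exists_smul_rep_eq (rfl : Projectivization.mk K v hv = _)
    rw [← hrep] at hvy hvw
    have hry := (Submodule.smul_mem_iff _ ht).mp hvy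
    have hrw := (Submodule.smul_mem_iff _ ht).mp hvw
    exact Set.mem_biUnion (x := Projectivization.mk K v hv)
      ⟨(hCsub hy).2 (mem_lineOf.mpr hry), mem_lineOfRep.mpr hrw⟩ hry
  obtain ⟨r, hr, hCr⟩ := hCirr.exists_subset_of_finite hfinite
    (fun r _ => zClosed_linesThrough r.rep) hCcov
  obtain ⟨s, hs, hsr⟩ := Set.exists_ne_of_one_lt_ncard hcard' r
  obtain ⟨y, hy, hsy⟩ := hcov s hs.1
  have hli := linearIndependent_rep_pair hsr
  have h1 := lineSub_eq_span_pair hw hli (mem_lineOfRep.mp hs.2) (mem_lineOfRep.mp hr.2)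
  have h2 := lineSub_eq_span_pair (isLineRep_rep (hCsub hy).1) hli (mem_lineOf.mp hsy) (hCr hy)
  refine hwS fun u hu => (hCsub hy).2 ?_
  rw [mem_lineOf, h2, ← h1]
  exact mem_lineOfRep.mp hu

/-- If the lines of `C` all meet two distinct lines with a common point `q`, they all pass through
`q` or all lie in one plane. -/
theorem forall_mem_or_forall_le {C : Set (PP K 6)} (hCgr : C ⊆ grass K) (hCirr : ZIrred C)
    {w z : Fin 6 → K} (hw : IsLineRep w) (hz : IsLineRep z) (hne : lineSub w ≠ lineSub z)
    {q : Fin 4 → K} (hq : q ≠ 0) (hqw : q ∈ lineSub w) (hqz : q ∈ lineSub z)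
    (hCw : ∀ y ∈ C, plPair w y.rep = 0) (hCz : ∀ y ∈ C, plPair z y.rep = 0) :
    (∀ y ∈ C, q ∈ lineSub y.rep) ∨ ∀ y ∈ C, lineSub y.rep ≤ lineSub w ⊔ lineSub z := by
  have hor : ∀ y ∈ C, q ∈ lineSub y.rep ∨ lineSub y.rep ≤ lineSub w ⊔ lineSub z := fun y hy =>
    mem_or_le_sup_of_plPair_eq_zero hw hz (isLineRep_rep (hCgr hy)) hne hq hqw hqz (hCw y hy)
      (hCz y hy)
  have hoff : ∀ {u u' : Fin 6 → K}, IsLineRep u → IsLineRep u' → lineSub u ≠ lineSub u' →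
      ∃ a ∈ lineSub u, a ∉ lineSub u' := by
    intro u u' hu hu' huu'
    by_contra! hle
    exact huu' (Submodule.eq_of_le_of_finrank_eq hle
      (by rw [finrank_lineSub hu, finrank_lineSub hu']))
  obtain ⟨a, haw, haz⟩ := hoff hw hz hne
  obtain ⟨b, hbz, hbw⟩ := hoff hz hw hne.symm
  have ha0 : a ≠ 0 := fun h => haz (h ▸ Submodule.zero_mem _)
  have hab : LinearIndependent K ![a, b] := by
    rw [LinearIndependent.pair_iff' ha0]
    rintro t rfl
    exact hbw (Submodule.smul_mem _ t haw)
  have hm := isLineRep_plucker hab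
  have hmspan := lineSub_plucker hm.1
  have hmH : lineSub (plucker a b) ≤ lineSub w ⊔ lineSub z := by
    rw [hmspan, Submodule.span_le]
    rintro v (rfl | rfl)
    · exact Submodule.mem_sup_left haw
    · exact Submodule.mem_sup_right hbz
  have hqm : q ∉ lineSub (plucker a b) := by
    rw [hmspan, Submodule.mem_span_pair]
    rintro ⟨s, t, hst⟩
    have ht : t • b ∈ lineSub w := by
      rw [eq_sub_iff_add_eq'.mpr hst]
      exact Submodule.sub_mem _ hqw (Submodule.smul_mem _ s haw)
    have hs : s • a ∈ lineSub z := by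
      rw [eq_sub_iff_add_eq.mpr hst]
      exact Submodule.sub_mem _ hqz (Submodule.smul_mem _ t hbz)
    have ht0 : t = 0 := by
      by_contra h
      exact hbw ((Submodule.smul_mem_iff _ h).mp ht)
    have hs0 : s = 0 := by
      by_contra h
      exact haz ((Submodule.smul_mem_iff _ h).mp hs)
    exact hq (by rw [← hst, hs0, ht0, zero_smul, zero_smul, add_zero])
  have hH := finrank_sup_lineSub hw hz hne hq hqw hqz
  rcases hCirr.2 _ _ (zClosed_linesThrough q) (zClosed_hyp (plDual (plucker a b)))
    (fun y hy => (hor y hy).imp id fun hle => mem_hyp_plDual.mpr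
      (plPair_eq_zero_of_le hm (isLineRep_rep (hCgr hy)) hH hmH hle)) with h | h
  · exact Or.inl h
  · refine Or.inr fun y hy => (hor y hy).elim (fun hqy => ?_) id
    have hyl := isLineRep_rep (hCgr hy)
    obtain ⟨v, hv, hvm, hvy⟩ := (plPair_eq_zero_iff hm hyl).mp (mem_hyp_plDual.mp (h hy))
    have hli : LinearIndependent K ![q, v] := by
      rw [LinearIndependent.pair_iff' hq]
      rintro t rfl
      exact hqm ((Submodule.smul_mem_iff _ (left_ne_zero_of_smul hv)).mp hvm)
    rw [lineSub_eq_span_pair hyl hli hqy hvy, Submodule.span_le]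
    rintro u (rfl | rfl)
    · exact Submodule.mem_sup_left hqw
    · exact hmH hvm

/-- A curve of lines of degree at least three has no three pairwise skew common transversals. -/
theorem not_pairwise_skew_transversals {C : Set (PP K 6)} (hCgr : C ⊆ grass K) {d : ℕ}
    (hd : 3 ≤ d) (hCdeg : HasCurveDeg C d) {w : Fin 3 → Fin 6 → K} (hw : ∀ i, IsLineRep (w i))
    (hCw : ∀ i, ∀ y ∈ C, plPair (w i) y.rep = 0) :
    ¬ ∀ i j, i ≠ j → plPair (w i) (w j) ≠ 0 := by
  intro hskew
  obtain ⟨-, φ, -, hCφ, hcard⟩ := hCdeg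
  have hfinite : (C ∩ hyp φ).Finite := Set.finite_of_ncard_pos (by omega)
  obtain ⟨x, y, z, hx, hy, hz, hxy, hxz, hyz⟩ := (Set.two_lt_ncard_iff hfinite).mp (by omega)
  obtain ⟨u, huC, hu⟩ := Set.not_subset.mp hCφ
  have hne : ∀ {a b : PP K 6}, a ∈ C → b ∈ C → a ≠ b → plPair a.rep b.rep ≠ 0 :=
    fun ha hb hab => plPair_ne_zero_of_transversals hw hskew (isLineRep_rep (hCgr ha))
      (isLineRep_rep (hCgr hb)) (fun h => hab (eq_of_lineSub_eq (hCgr ha) (hCgr hb) h))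
      (fun i => hCw i _ ha) (fun i => hCw i _ hb)
  have hz3 : LinearIndependent K ![x.rep, y.rep, z.rep] := by
    refine linearIndependent_of_pairwise_skew (fun i => ?_) fun i j hij => ?_
    · fin_cases i
      exacts [(isLineRep_rep (hCgr hx.1)).2, (isLineRep_rep (hCgr hy.1)).2,
        (isLineRep_rep (hCgr hz.1)).2]
    · fin_cases i <;> fin_cases j <;> first
        | exact absurd rfl hij
        | exact hne hx.1 hy.1 hxy
        | exact hne hx.1 hz.1 hxz
        | exact hne hy.1 hz.1 hyz
        | exact hne hy.1 hx.1 hxy.symm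
        | exact hne hz.1 hx.1 hxz.symm
        | exact hne hz.1 hy.1 hyz.symm
  have hmem := mem_span_of_orthogonal
    (linearIndependent_of_pairwise_skew (fun i => (hw i).2) hskew) hz3
    (fun i j => by
      fin_cases j
      exacts [hCw i _ hx.1, hCw i _ hy.1, hCw i _ hz.1])
    (fun i => hCw i u huC)
  have hle : Submodule.span K (Set.range ![x.rep, y.rep, z.rep]) ≤
      LinearMap.ker (∑ i, φ i • LinearMap.proj (R := K) (φ := fun _ : Fin 6 => K) i) := by
    rw [Submodule.span_le]
    rintro _ ⟨j, rfl⟩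
    have hker : ∀ {a : PP K 6}, a ∈ hyp φ →
        a.rep ∈ LinearMap.ker (∑ i, φ i • LinearMap.proj (R := K) (φ := fun _ : Fin 6 => K) i) :=
      fun ha => by simpa using mem_hyp.mp ha
    fin_cases j
    exacts [hker hx.2, hker hy.2, hker hz.2]
  exact hu (mem_hyp.mpr (by simpa using hle hmem))

/-! STATEMENT 5: a ruled surface of degree ≥ 3 (not a cone) has at most two isolated
lines, and two isolated lines are disjoint. -/

theorem statement_5 (K : Type) [Field K] [IsAlgClosed K]
    (S : Set (PP K 4)) (d : ℕ) (hd : 3 ≤ d)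
    (hruled : IsRuled S) (hdeg : HasSurfDeg S d) (hcone : ¬ IsCone S)
    -- `C` is the irreducible degree-`d` curve component of the set `C̃ = linesOf S`
    -- of lines on `S`, the complement (the set of isolated lines) being finite:
    (C : Set (PP K 6)) (hCsub : C ⊆ linesOf S)
    (hCcl : ZClosed C) (hCirr : ZIrred C) (hCdim : HasDim C 1) (hCdeg : HasCurveDeg C d)
    (hfin : (linesOf S \ C).Finite) :
    (linesOf S \ C).ncard ≤ 2 ∧
    ∀ x₁ ∈ linesOf S \ C, ∀ x₂ ∈ linesOf S \ C, x₁ ≠ x₂ →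
      lineOf x₁ ∩ lineOf x₂ = ∅ := by
  have hcov : ∀ p ∈ S, ∃ y ∈ C, p ∈ lineOf y := fun p hp =>
    exists_mem_lineOf_of_cofinite (by omega) hruled hdeg hCcl hfin hp
  have hCgr : C ⊆ grass K := fun y hy => (hCsub hy).1
  have hmeet : ∀ x ∈ linesOf S \ C, ∀ y ∈ C, plPair x.rep y.rep = 0 := fun x hx y hy =>
    plPair_eq_zero_of_isolated hCsub hCdeg hcov hx hy
  have hplane : ∀ H : Submodule K (Fin 4 → K), Module.finrank K H = 3 →
      ¬ ∀ y ∈ C, lineSub y.rep ≤ H := fun H hH =>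
    not_forall_lineSub_le (by omega) hdeg hCsub hCirr hcov hH
  have hdisj : ∀ x₁ ∈ linesOf S \ C, ∀ x₂ ∈ linesOf S \ C, x₁ ≠ x₂ →
      lineOf x₁ ∩ lineOf x₂ = ∅ := by
    intro x₁ hx₁ x₂ hx₂ hne
    by_contra hint
    obtain ⟨p, hp₁, hp₂⟩ := Set.nonempty_iff_ne_empty.mpr hint
    rw [mem_lineOf] at hp₁ hp₂
    have hl₁ := isLineRep_rep hx₁.1.1
    have hl₂ := isLineRep_rep hx₂.1.1
    have hne' : lineSub x₁.rep ≠ lineSub x₂.rep := fun h =>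
      hne (eq_of_lineSub_eq hx₁.1.1 hx₂.1.1 h)
    rcases forall_mem_or_forall_le hCgr hCirr hl₁ hl₂ hne' p.rep_nonzero hp₁ hp₂ (hmeet x₁ hx₁)
      (hmeet x₂ hx₂) with h | h
    · refine hcone ⟨p, fun x hx => ?_⟩
      rw [mem_lineOf]
      by_contra hpx
      have hxC : x ∉ C := fun hxC => hpx (h x hxC)
      have hxl := isLineRep_rep hx.1
      have hH : Module.finrank K (lineSub x.rep ⊔ Submodule.span K {p.rep} : Submodule K _) = 3 := by
        have hsum := Submodule.finrank_sup_add_finrank_inf_eq (lineSub x.rep)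
          (Submodule.span K {p.rep})
        rw [(Submodule.disjoint_span_singleton_of_notMem hpx).eq_bot, finrank_bot,
          finrank_lineSub hxl, finrank_span_singleton p.rep_nonzero] at hsum
        exact hsum
      refine hplane _ hH fun y hy => ?_
      have hyl := isLineRep_rep (hCgr hy)
      obtain ⟨v, hv, hvx, hvy⟩ := (plPair_eq_zero_iff hxl hyl).mp (hmeet x ⟨hx, hxC⟩ y hy)
      have hli : LinearIndependent K ![v, p.rep] := by
        rw [LinearIndependent.pair_iff' hv]
        intro t ht
        exact hpx (ht ▸ Submodule.smul_mem _ t hvx)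
      rw [lineSub_eq_span_pair hyl hli hvy (h y hy), Submodule.span_le]
      rintro u (rfl | rfl)
      · exact Submodule.mem_sup_left hvx
      · exact Submodule.mem_sup_right (Submodule.mem_span_singleton_self _)
    · exact hplane _ (finrank_sup_lineSub hl₁ hl₂ hne' p.rep_nonzero hp₁ hp₂) h
  refine ⟨?_, hdisj⟩
  by_contra! hcard
  obtain ⟨x, y, z, hx, hy, hz, hxy, hxz, hyz⟩ := (Set.two_lt_ncard_iff hfin).mp hcard
  have hskew : ∀ {a b : PP K 6}, a ∈ linesOf S \ C → b ∈ linesOf S \ C → a ≠ b →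
      plPair a.rep b.rep ≠ 0 := by
    intro a b ha hb hab h0
    obtain ⟨v, hv, hva, hvb⟩ :=
      (plPair_eq_zero_iff (isLineRep_rep ha.1.1) (isLineRep_rep hb.1.1)).mp h0
    obtain ⟨t, ht, hrep⟩ := exists_smul_rep_eq (rfl : Projectivization.mk K v hv = _)
    rw [← hrep] at hva hvb
    have hmem : Projectivization.mk K v hv ∈ lineOf a ∩ lineOf b :=
      ⟨mem_lineOf.mpr ((Submodule.smul_mem_iff _ ht).mp hva),
        mem_lineOf.mpr ((Submodule.smul_mem_iff _ ht).mp hvb)⟩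
    rw [hdisj a ha b hb hab] at hmem
    exact hmem
  have hmem : ∀ i, ![x, y, z] i ∈ linesOf S \ C := by
    intro i
    fin_cases i <;> assumption
  refine not_pairwise_skew_transversals hCgr hd hCdeg (w := fun i => (![x, y, z] i).rep)
    (fun i => isLineRep_rep (hmem i).1.1) (fun i => hmeet _ (hmem i)) fun i j hij =>
      hskew (hmem i) (hmem j) ?_
  fin_cases i <;> fin_cases j <;> simp_all [eq_comm]

end RQS
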